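/- arXiv:2605.04105 — 2 statements merged into one kernel-verified Lean document; each statement's English description precedes it below -/
import Mathlib

section
/- Let n ≥ 5, N ≥ 1, and let φ be a symmetric 2-coloring of pairs of distinct natural numbers less than N such that every n-element subset A of {0,1,...,N−1} contains elements a < b < c with φ(a,b) = φ(b,c) ≠ φ(a,c). Let Q = (v_1 < v_2 < ... < v_m) be a subset of {0,1,...,2^N − 1} that is independent in H, set δ_i = δ(v_i, v_{i+1}), and let I = {i_1 < ... < i_k} ⊆ {1,...,m−1} satisfy property (∗): for every two consecutive elements i_j < i_{j+1} of I, δ_x < max(δ_{i_j}, δ_{i_{j+1}}) for all i_j < x < i_{j+1}. Then the sequence (δ_{i_1}, δ_{i_2}, ..., δ_{i_k}) contains no n consecutive terms that are strictly monotone, i.e., there is no j with δ_{i_j} < δ_{i_{j+1}} < ... < δ_{i_{j+n−1}} or δ_{i_j} > δ_{i_{j+1}} > ... > δ_{i_{j+n−1}}. -/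
/-- For distinct natural numbers `a` and `b`, `delta a b` is the largest index `i`
such that the `i`-th binary digits of `a` and `b` differ (the position of the
highest set bit of `a XOR b`). -/
def delta (a b : ℕ) : ℕ := Nat.log 2 (a ^^^ b)

/-- The edge predicate of the 4-uniform hypergraph `H` determined by a symmetric
2-coloring `φ` of pairs: for `v₁ < v₂ < v₃ < v₄` with `δᵢ = delta vᵢ v_{i+1}`,
`(v₁,v₂,v₃,v₄)` is an edge iff one of the conditions (i), (ii), (iii) holds. -/
def IsEdge (φ : ℕ → ℕ → Bool) (v₁ v₂ v₃ v₄ : ℕ) : Prop :=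
  (((delta v₁ v₂ < delta v₂ v₃ ∧ delta v₂ v₃ < delta v₃ v₄) ∨
    (delta v₂ v₃ < delta v₁ v₂ ∧ delta v₃ v₄ < delta v₂ v₃)) ∧
    φ (delta v₁ v₂) (delta v₂ v₃) = φ (delta v₂ v₃) (delta v₃ v₄) ∧
    φ (delta v₁ v₂) (delta v₂ v₃) ≠ φ (delta v₁ v₂) (delta v₃ v₄)) ∨
  (delta v₂ v₃ < delta v₁ v₂ ∧ delta v₂ v₃ < delta v₃ v₄ ∧
    delta v₃ v₄ < delta v₁ v₂ ∧
    φ (delta v₁ v₂) (delta v₂ v₃) ≠ φ (delta v₂ v₃) (delta v₃ v₄)) ∨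
  (delta v₂ v₃ < delta v₁ v₂ ∧ delta v₂ v₃ < delta v₃ v₄ ∧
    delta v₁ v₂ < delta v₃ v₄ ∧
    φ (delta v₁ v₂) (delta v₂ v₃) = φ (delta v₁ v₂) (delta v₃ v₄) ∧
    φ (delta v₁ v₂) (delta v₃ v₄) = φ (delta v₂ v₃) (delta v₃ v₄))

/-- The `δ`-sequence of an increasing sequence of vertices `v`:
`dseq v i = delta (v i) (v (i+1))`. -/
def dseq (v : ℕ → ℕ) (i : ℕ) : ℕ := delta (v i) (v (i + 1))

/-- Adding (xor) a number below `2 ^ log₂ q` does not change the binary logarithm of `q`. -/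
theorem log_two_xor_of_lt {p q : ℕ} (h : p < 2 ^ Nat.log 2 q) :
    Nat.log 2 (p ^^^ q) = Nat.log 2 q := by
  rcases Nat.eq_zero_or_pos q with rfl | hq
  · have hp : p = 0 := by simpa using h
    simp [hp]
  · have hlt : p ^^^ q < 2 ^ (Nat.log 2 q + 1) :=
      Nat.xor_lt_two_pow (h.trans (Nat.pow_lt_pow_right one_lt_two (Nat.lt_succ_self _)))
        (Nat.lt_pow_succ_log_self one_lt_two q)
    have hle : 2 ^ Nat.log 2 q ≤ p ^^^ q := by
      by_contra! hcon
      have hq' : q < 2 ^ Nat.log 2 q := by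
        have := Nat.xor_lt_two_pow h hcon
        rwa [← Nat.xor_assoc, Nat.xor_self, Nat.zero_xor] at this
      exact absurd (Nat.pow_log_le_self 2 hq.ne') (not_le.mpr hq')
    exact Nat.log_eq_of_pow_le_of_lt_pow hle hlt

/-- If every `δ`-value strictly between two positions is below `b`, then the vertices at these
positions agree in all binary digits from `b` on. -/
theorem xor_lt_two_pow_of_dseq_lt {v : ℕ → ℕ} {b p q : ℕ} (hpq : p ≤ q)
    (h : ∀ x, p ≤ x → x < q → dseq v x < b) : v p ^^^ v q < 2 ^ b := by
  induction q, hpq using Nat.le_induction with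
  | base => simp
  | succ q hpq ih =>
    have h₁ := ih fun x hx hxq => h x hx (by omega)
    have h₂ : v q ^^^ v (q + 1) < 2 ^ b :=
      Nat.lt_pow_of_log_lt one_lt_two (h q hpq (Nat.lt_succ_self q))
    have := Nat.xor_lt_two_pow h₁ h₂
    rwa [Nat.xor_assoc, ← Nat.xor_assoc (v q), Nat.xor_self, Nat.zero_xor] at this

theorem delta_eq_dseq_last {v : ℕ → ℕ} {p q : ℕ} (hpq : p ≤ q)
    (h : ∀ x, p ≤ x → x < q → dseq v x < dseq v q) : delta (v p) (v (q + 1)) = dseq v q := by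
  have := log_two_xor_of_lt (q := v q ^^^ v (q + 1)) (xor_lt_two_pow_of_dseq_lt hpq h)
  rwa [Nat.xor_assoc, ← Nat.xor_assoc (v q), Nat.xor_self, Nat.zero_xor] at this

theorem delta_eq_dseq_first {v : ℕ → ℕ} {p q : ℕ} (hpq : p < q)
    (h : ∀ x, p < x → x < q → dseq v x < dseq v p) : delta (v p) (v q) = dseq v p := by
  have := log_two_xor_of_lt (q := v p ^^^ v (p + 1)) (xor_lt_two_pow_of_dseq_lt hpq h)
  rwa [Nat.xor_comm, Nat.xor_assoc, ← Nat.xor_assoc (v (p + 1)), Nat.xor_self,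
    Nat.zero_xor] at this

/-- Along an increasing run with controlled gaps, the last value dominates all earlier ones. -/
theorem lt_last_of_increasing_run {d f : ℕ → ℕ} {n : ℕ}
    (hgap : ∀ t, t + 1 < n → ∀ x, f t < x → x < f (t + 1) → d x < max (d (f t)) (d (f (t + 1))))
    (hinc : ∀ t, t + 1 < n → d (f t) < d (f (t + 1))) {s t x : ℕ} (ht : t < n)
    (hst : s ≤ t) (hsx : f s ≤ x) (hxt : x < f t) : d x < d (f t) := by
  induction t, hst using Nat.le_induction with
  | base => omega
  | succ t hst ih =>
    have hlt := hinc t ht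
    rcases lt_trichotomy x (f t) with hx | rfl | hx
    · exact (ih (by omega) hx).trans hlt
    · exact hlt
    · simpa [max_eq_right hlt.le] using hgap t ht x hx hxt

/-- Along a decreasing run with controlled gaps, the first value dominates all later ones. -/
theorem lt_first_of_decreasing_run {d f : ℕ → ℕ} {n : ℕ} (hf : ∀ s t, s < t → t < n → f s < f t)
    (hgap : ∀ t, t + 1 < n → ∀ x, f t < x → x < f (t + 1) → d x < max (d (f t)) (d (f (t + 1))))
    (hdec : ∀ t, t + 1 < n → d (f (t + 1)) < d (f t)) {s t x : ℕ} (ht : t < n)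
    (hst : s ≤ t) (hsx : f s < x) (hxt : x ≤ f t) : d x < d (f s) := by
  induction t, hst using Nat.le_induction generalizing x with
  | base => omega
  | succ t hst ih =>
    have hlt := hdec t ht
    rcases le_or_gt x (f t) with hx | hx
    · exact ih (by omega) hsx hx
    · have hle : d x < d (f t) := by
        rcases hxt.lt_or_eq with hx' | rfl
        · simpa [max_eq_left hlt.le] using hgap t ht x hx hx'
        · exact hlt
      rcases hst.lt_or_eq with hst' | rfl
      · exact hle.trans (ih (by omega) (hf s t hst' (by omega)) le_rfl)
      · exact hle

/-- A coloring for which every `n`-set contains a pattern `φ a b = φ b c ≠ φ a c` has such a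
pattern in the image of any injective `n`-term sequence. -/
theorem exists_pattern_of_injOn {φ : ℕ → ℕ → Bool} {n N : ℕ}
    (hφ : ∀ A : Finset ℕ, A ⊆ Finset.range N → A.card = n →
      ∃ a ∈ A, ∃ b ∈ A, ∃ c ∈ A, a < b ∧ b < c ∧ φ a b = φ b c ∧ φ a b ≠ φ a c)
    {g : ℕ → ℕ} (hgN : ∀ t, t < n → g t < N) (hinj : ∀ s t, s < t → t < n → g s ≠ g t) :
    ∃ s t u, s < n ∧ t < n ∧ u < n ∧ g s < g t ∧ g t < g u ∧
      φ (g s) (g t) = φ (g t) (g u) ∧ φ (g s) (g t) ≠ φ (g s) (g u) := by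
  obtain ⟨a, ha, b, hb, c, hc, h⟩ := hφ ((Finset.range n).image g)
    (by
      intro y hy
      obtain ⟨t, ht, rfl⟩ := Finset.mem_image.mp hy
      exact Finset.mem_range.mpr (hgN t (Finset.mem_range.mp ht)))
    (by
      rw [Finset.card_image_of_injOn, Finset.card_range]
      intro s hs t ht hst
      have hs' : s < n := by simpa using hs
      have ht' : t < n := by simpa using ht
      rcases lt_trichotomy s t with hlt | heq | hlt
      · exact absurd hst (hinj s t hlt ht')
      · exact heq
      · exact absurd hst.symm (hinj t s hlt hs'))
  obtain ⟨s, hs, rfl⟩ := Finset.mem_image.mp ha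
  obtain ⟨t, ht, rfl⟩ := Finset.mem_image.mp hb
  obtain ⟨u, hu, rfl⟩ := Finset.mem_image.mp hc
  exact ⟨s, t, u, Finset.mem_range.mp hs, Finset.mem_range.mp ht, Finset.mem_range.mp hu, h⟩


theorem no_long_monotone_run (n N m k : ℕ) (hn : 5 ≤ n) (hN : 1 ≤ N)
    (φ : ℕ → ℕ → Bool) (hsym : ∀ a b, φ a b = φ b a)
    (hφ : ∀ A : Finset ℕ, A ⊆ Finset.range N → A.card = n →
      ∃ a ∈ A, ∃ b ∈ A, ∃ c ∈ A, a < b ∧ b < c ∧ φ a b = φ b c ∧ φ a b ≠ φ a c)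
    (v : ℕ → ℕ) (hv : ∀ i j, i < j → j < m → v i < v j)
    (hvN : ∀ i, i < m → v i < 2 ^ N)
    (hind : ∀ i j l r, i < j → j < l → l < r → r < m →
      ¬ IsEdge φ (v i) (v j) (v l) (v r))
    (idx : ℕ → ℕ) (hmono : ∀ a b, a < b → b < k → idx a < idx b)
    (hrange : ∀ j, j < k → idx j < m - 1)
    (hstar : ∀ j, j + 1 < k → ∀ x, idx j < x → x < idx (j + 1) →
      dseq v x < max (dseq v (idx j)) (dseq v (idx (j + 1)))) :
    ¬ ∃ j, j + n ≤ k ∧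
        ((∀ t, t + 1 < n → dseq v (idx (j + t)) < dseq v (idx (j + t + 1))) ∨
         (∀ t, t + 1 < n → dseq v (idx (j + t + 1)) < dseq v (idx (j + t)))) := by
  rintro ⟨j, hjk, hrun⟩
  set f : ℕ → ℕ := fun t => idx (j + t) with hfdef
  have hf : ∀ s t, s < t → t < n → f s < f t := fun s t hst ht =>
    hmono _ _ (by omega) (by omega)
  have hfm : ∀ t, t < n → f t + 1 < m := fun t ht => by
    have := hrange (j + t) (by omega)
    simp only [hfdef]
    omega
  have hgap : ∀ t, t + 1 < n → ∀ x, f t < x → x < f (t + 1) →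
      dseq v x < max (dseq v (f t)) (dseq v (f (t + 1))) := fun t ht x hx hx' =>
    hstar (j + t) (by omega) x hx hx'
  have hgN : ∀ t, t < n → dseq v (f t) < N := fun t ht => by
    have hm := hfm t ht
    have hlt := Nat.xor_lt_two_pow (hvN (f t) (by omega)) (hvN (f t + 1) hm)
    exact Nat.log_lt_of_lt_pow' (by omega) hlt
  rcases hrun with hinc | hdec
  · have hlast {s t x : ℕ} (ht : t < n) (hst : s ≤ t) (hsx : f s ≤ x) (hxt : x < f t) :
        dseq v x < dseq v (f t) := lt_last_of_increasing_run hgap hinc ht hst hsx hxt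
    have hlt : ∀ s t, s < t → t < n → dseq v (f s) < dseq v (f t) := fun s t hst ht =>
      hlast ht hst.le le_rfl (hf s t hst ht)
    obtain ⟨s, t, u, hs, ht, hu, hab, hbc, hφ₁, hφ₂⟩ :=
      exists_pattern_of_injOn hφ hgN fun s t hst ht => (hlt s t hst ht).ne
    have hst : s < t := by
      by_contra! hle
      rcases hle.lt_or_eq with h | rfl
      · exact absurd (hlt t s h hs) hab.not_gt
      · exact hab.false
    have htu : t < u := by
      by_contra! hle
      rcases hle.lt_or_eq with h | rfl
      · exact absurd (hlt u t h ht) hbc.not_gt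
      · exact hbc.false
    have hfst := hf s t hst ht
    have hftu := hf t u htu hu
    have hb : delta (v (f s + 1)) (v (f t + 1)) = dseq v (f t) :=
      delta_eq_dseq_last hfst fun x hx hx' => hlast ht hst.le (by omega) hx'
    have hc : delta (v (f t + 1)) (v (f u + 1)) = dseq v (f u) :=
      delta_eq_dseq_last hftu fun x hx hx' => hlast hu htu.le (by omega) hx'
    have ha : delta (v (f s)) (v (f s + 1)) = dseq v (f s) := rfl
    refine hind (f s) (f s + 1) (f t + 1) (f u + 1) (by omega) (by omega) (by omega) (hfm u hu)
      (Or.inl ?_)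
    rw [ha, hb, hc]
    exact ⟨Or.inl ⟨hab, hbc⟩, hφ₁, hφ₂⟩
  · have hfirst {s t x : ℕ} (ht : t < n) (hst : s ≤ t) (hsx : f s < x) (hxt : x ≤ f t) :
        dseq v x < dseq v (f s) := lt_first_of_decreasing_run hf hgap hdec ht hst hsx hxt
    have hlt : ∀ s t, s < t → t < n → dseq v (f t) < dseq v (f s) := fun s t hst ht =>
      hfirst ht hst.le (hf s t hst ht) le_rfl
    obtain ⟨u, t, s, hu, ht, hs, hab, hbc, hφ₁, hφ₂⟩ :=
      exists_pattern_of_injOn hφ hgN fun s t hst ht => (hlt s t hst ht).ne'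
    have hst : s < t := by
      by_contra! hle
      rcases hle.lt_or_eq with h | rfl
      · exact absurd (hlt t s h hs) hbc.not_gt
      · exact hbc.false
    have htu : t < u := by
      by_contra! hle
      rcases hle.lt_or_eq with h | rfl
      · exact absurd (hlt u t h ht) hab.not_gt
      · exact hab.false
    have hfst := hf s t hst ht
    have hftu := hf t u htu hu
    have hc : delta (v (f s)) (v (f t)) = dseq v (f s) :=
      delta_eq_dseq_first hfst fun x hx hx' => hfirst ht hst.le hx hx'.le
    have hb : delta (v (f t)) (v (f u)) = dseq v (f t) :=
      delta_eq_dseq_first hftu fun x hx hx' => hfirst hu htu.le hx hx'.le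
    have ha : delta (v (f u)) (v (f u + 1)) = dseq v (f u) := rfl
    refine hind (f s) (f t) (f u) (f u + 1) hfst hftu (by omega) (hfm u hu) (Or.inl ?_)
    rw [ha, hb, hc, hsym (dseq v (f s)) (dseq v (f t)), hsym (dseq v (f t)) (dseq v (f u)),
      hsym (dseq v (f s)) (dseq v (f u))]
    exact ⟨Or.inr ⟨hbc, hab⟩, hφ₁.symm, hφ₁ ▸ hφ₂⟩
end

section
/- Let n ≥ 5, N ≥ 1, and let φ be a symmetric 2-coloring of pairs of distinct natural numbers less than N such that every n-element subset A of {0,1,...,N−1} contains elements a < b < c with φ(a,b) = φ(b,c) ≠ φ(a,c). Then the 4-uniform hypergraph H has independence number less than 2^6·n^5 + 1: every subset of {0,1,...,2^N − 1} with 2^6·n^5 + 1 elements contains four elements forming an edge of H. -/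
theorem xor_lt_two_pow_iff (a b k : ℕ) : a ^^^ b < 2 ^ k ↔ a / 2 ^ k = b / 2 ^ k := by
  rw [← Nat.div_eq_zero_iff_lt (by positivity), ← Nat.shiftRight_eq_div_pow,
    Nat.shiftRight_xor_distrib, Nat.xor_eq_zero_iff, Nat.shiftRight_eq_div_pow,
    Nat.shiftRight_eq_div_pow]

theorem delta_lt_iff {a b k : ℕ} (h : a ≠ b) : delta a b < k ↔ a / 2 ^ k = b / 2 ^ k := by
  rw [← xor_lt_two_pow_iff, delta]
  exact Nat.log_lt_iff_lt_pow (by norm_num) (by rwa [Ne, Nat.xor_eq_zero_iff])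

theorem delta_eq_iff {a b d : ℕ} (h : a < b) :
    delta a b = d ↔ a / 2 ^ d % 2 = 0 ∧ b / 2 ^ d = a / 2 ^ d + 1 := by
  have h1 := delta_lt_iff (k := d) h.ne
  have h2 := delta_lt_iff (k := d + 1) h.ne
  rw [pow_succ, ← Nat.div_div_eq_div_mul, ← Nat.div_div_eq_div_mul] at h2
  have h3 : a / 2 ^ d ≤ b / 2 ^ d := Nat.div_le_div_right h.le
  omega

/-- `A` and `B` lie in the left and the right subtree of a branching of `S` at level `d`. -/
structure IsNode (S : Finset ℕ) (d : ℕ) (A B : Finset ℕ) : Prop where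
  left : A ⊆ S
  right : B ⊆ S
  left_nonempty : A.Nonempty
  right_nonempty : B.Nonempty
  lt : ∀ a ∈ A, ∀ b ∈ B, a < b
  delta_eq : ∀ a ∈ A, ∀ b ∈ B, delta a b = d

namespace IsNode

variable {S T A B C D E F : Finset ℕ} {x y z : ℕ}

theorem mono (h : IsNode S x A B) (hS : S ⊆ T) : IsNode T x A B :=
  { h with left := h.left.trans hS, right := h.right.trans hS }

theorem delta_lt_left (h : IsNode S x A B) {a b : ℕ} (ha : a ∈ A) (hb : b ∈ A) (hab : a < b) :
    delta a b < x := by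
  obtain ⟨c, hc⟩ := h.right_nonempty
  have h1 := (delta_eq_iff (h.lt a ha c hc)).1 (h.delta_eq a ha c hc)
  have h2 := (delta_eq_iff (h.lt b hb c hc)).1 (h.delta_eq b hb c hc)
  rw [delta_lt_iff hab.ne]
  omega

theorem delta_lt_right (h : IsNode S x A B) {a b : ℕ} (ha : a ∈ B) (hb : b ∈ B) (hab : a < b) :
    delta a b < x := by
  obtain ⟨c, hc⟩ := h.left_nonempty
  have h1 := (delta_eq_iff (h.lt c hc a ha)).1 (h.delta_eq c hc a ha)
  have h2 := (delta_eq_iff (h.lt c hc b hb)).1 (h.delta_eq c hc b hb)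
  rw [delta_lt_iff hab.ne]
  omega

theorem lt_of_left (h : IsNode S x A B) (h' : IsNode A y C D) : y < x := by
  obtain ⟨c, hc⟩ := h'.left_nonempty
  obtain ⟨d, hd⟩ := h'.right_nonempty
  rw [← h'.delta_eq c hc d hd]
  exact h.delta_lt_left (h'.left hc) (h'.right hd) (h'.lt c hc d hd)

theorem lt_of_right (h : IsNode S x A B) (h' : IsNode B y C D) : y < x := by
  obtain ⟨c, hc⟩ := h'.left_nonempty
  obtain ⟨d, hd⟩ := h'.right_nonempty
  rw [← h'.delta_eq c hc d hd]
  exact h.delta_lt_right (h'.left hc) (h'.right hd) (h'.lt c hc d hd)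

/-- A set with at least two elements splits at its topmost branching. -/
theorem exists_of_one_lt_card (hS : 1 < S.card) :
    ∃ d A B, IsNode S d A B ∧ S.card = A.card + B.card := by
  have hne : S.Nonempty := Finset.card_pos.1 (by omega)
  have hlt : S.min' hne < S.max' hne := Finset.min'_lt_max'_of_card S hS
  generalize hd : delta (S.min' hne) (S.max' hne) = d
  obtain ⟨h1, h2⟩ := (delta_eq_iff hlt).1 hd
  have hval : ∀ x ∈ S, x / 2 ^ d = S.min' hne / 2 ^ d ∨ x / 2 ^ d = S.min' hne / 2 ^ d + 1 := by
    intro x hx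
    have h3 : S.min' hne / 2 ^ d ≤ x / 2 ^ d := Nat.div_le_div_right (S.min'_le x hx)
    have h4 : x / 2 ^ d ≤ S.max' hne / 2 ^ d := Nat.div_le_div_right (S.le_max' x hx)
    omega
  have hlt' : ∀ a ∈ S.filter (fun x => x / 2 ^ d = S.min' hne / 2 ^ d),
      ∀ b ∈ S.filter (fun x => ¬ x / 2 ^ d = S.min' hne / 2 ^ d), a < b := by
    intro a ha b hb
    rw [Finset.mem_filter] at ha hb
    by_contra! hba
    have h3 := hval b hb.1
    have h4 : b / 2 ^ d ≤ a / 2 ^ d := Nat.div_le_div_right hba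
    omega
  refine ⟨d, S.filter fun x => x / 2 ^ d = S.min' hne / 2 ^ d,
    S.filter fun x => ¬ x / 2 ^ d = S.min' hne / 2 ^ d,
    ⟨S.filter_subset _, S.filter_subset _,
      ⟨S.min' hne, Finset.mem_filter.2 ⟨S.min'_mem hne, rfl⟩⟩,
      ⟨S.max' hne, Finset.mem_filter.2 ⟨S.max'_mem hne, by omega⟩⟩, hlt', ?_⟩,
    (Finset.card_filter_add_card_filter_not _).symm⟩
  intro a ha b hb
  rw [delta_eq_iff (hlt' a ha b hb)]
  rw [Finset.mem_filter] at ha hb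
  have h3 := hval b hb.1
  rw [ha.2]
  omega

end IsNode

/-- `S` spans no edge of the hypergraph determined by `φ`. -/
def IsIndep (φ : ℕ → ℕ → Bool) (S : Finset ℕ) : Prop :=
  ∀ v₁ ∈ S, ∀ v₂ ∈ S, ∀ v₃ ∈ S, ∀ v₄ ∈ S,
    v₁ < v₂ → v₂ < v₃ → v₃ < v₄ → ¬ IsEdge φ v₁ v₂ v₃ v₄

namespace IsIndep

variable {φ : ℕ → ℕ → Bool} {S A B C D E F : Finset ℕ} {x y z : ℕ}

theorem mono {T : Finset ℕ} (h : IsIndep φ T) (hS : S ⊆ T) : IsIndep φ S :=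
  fun a ha b hb c hc d hd => h a (hS ha) b (hS hb) c (hS hc) d (hS hd)

theorem right_left (h : IsIndep φ S) (hsym : ∀ a b, φ a b = φ b a) (hx : IsNode S x A B)
    (hy : IsNode B y C D) (hz : IsNode C z E F) : φ x z = φ y z := by
  obtain ⟨a, ha⟩ := hx.left_nonempty
  obtain ⟨d, hd⟩ := hy.right_nonempty
  obtain ⟨e, he⟩ := hz.left_nonempty
  obtain ⟨f, hf⟩ := hz.right_nonempty
  have he' := hz.left he
  have hf' := hz.right hf
  have hyx := hx.lt_of_right hy
  have hzy := hy.lt_of_left hz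
  have key := h a (hx.left ha) e (hx.right (hy.left he')) f (hx.right (hy.left hf')) d
    (hx.right (hy.right hd)) (hx.lt a ha e (hy.left he')) (hz.lt e he f hf) (hy.lt f hf' d hd)
  rw [IsEdge, hx.delta_eq a ha e (hy.left he'), hz.delta_eq e he f hf,
    hy.delta_eq f hf' d hd] at key
  by_contra hne
  exact key (Or.inr (Or.inl ⟨by omega, hzy, hyx, by rwa [hsym z y]⟩))

theorem left_right (h : IsIndep φ S) (hsym : ∀ a b, φ a b = φ b a) (hx : IsNode S x A B)
    (hy : IsNode A y C D) (hz : IsNode D z E F) : ¬ (φ x y = φ y z ∧ φ x y = φ x z) := by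
  obtain ⟨b, hb⟩ := hx.right_nonempty
  obtain ⟨c, hc⟩ := hy.left_nonempty
  obtain ⟨e, he⟩ := hz.left_nonempty
  obtain ⟨f, hf⟩ := hz.right_nonempty
  have he' := hz.left he
  have hf' := hz.right hf
  have hyx := hx.lt_of_left hy
  have hzy := hy.lt_of_right hz
  have key := h c (hx.left (hy.left hc)) e (hx.left (hy.right he')) f (hx.left (hy.right hf')) b
    (hx.right hb) (hy.lt c hc e he') (hz.lt e he f hf) (hx.lt f (hy.right hf') b hb)
  rw [IsEdge, hy.delta_eq c hc e he', hz.delta_eq e he f hf,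
    hx.delta_eq f (hy.right hf') b hb] at key
  rintro ⟨h1, h2⟩
  refine key (Or.inr (Or.inr ⟨hzy, by omega, hyx, ?_, ?_⟩))
  · rw [hsym y x, h1]
  · rw [hsym y x, hsym z x, h2]

theorem left_left (h : IsIndep φ S) (hsym : ∀ a b, φ a b = φ b a) (hx : IsNode S x A B)
    (hy : IsNode A y C D) (hz : IsNode C z E F) : φ x y = φ y z → φ x y = φ x z := by
  obtain ⟨b, hb⟩ := hx.right_nonempty
  obtain ⟨d, hd⟩ := hy.right_nonempty
  obtain ⟨e, he⟩ := hz.left_nonempty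
  obtain ⟨f, hf⟩ := hz.right_nonempty
  have he' := hz.left he
  have hf' := hz.right hf
  have hyx := hx.lt_of_left hy
  have hzy := hy.lt_of_left hz
  have key := h e (hx.left (hy.left he')) f (hx.left (hy.left hf')) d (hx.left (hy.right hd)) b
    (hx.right hb) (hz.lt e he f hf) (hy.lt f hf' d hd) (hx.lt d (hy.right hd) b hb)
  rw [IsEdge, hz.delta_eq e he f hf, hy.delta_eq f hf' d hd,
    hx.delta_eq d (hy.right hd) b hb] at key
  intro h1
  by_contra hne
  refine key (Or.inl ⟨Or.inl ⟨hzy, hyx⟩, ?_, ?_⟩)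
  · rw [hsym z y, hsym y x, h1]
  · rw [hsym z y, hsym z x, ← h1]
    exact hne

end IsIndep

/-- `S` contains the leaves of a full binary tree with `k` levels of branchings. -/
def HasFullTree : ℕ → Finset ℕ → Prop
  | 0, S => S.Nonempty
  | k + 1, S => ∃ d A B, IsNode S d A B ∧ HasFullTree k A ∧ HasFullTree k B

theorem HasFullTree.mono {k : ℕ} {S T : Finset ℕ} (h : HasFullTree k S) (hS : S ⊆ T) :
    HasFullTree k T := by
  cases k with
  | zero => exact Finset.Nonempty.mono hS h
  | succ k =>
    obtain ⟨d, A, B, hd, hA, hB⟩ := h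
    exact ⟨d, A, B, hd.mono hS, hA, hB⟩

theorem IsIndep.not_hasFullTree_six {φ : ℕ → ℕ → Bool} {S : Finset ℕ} (h : IsIndep φ S)
    (hsym : ∀ a b, φ a b = φ b a) : ¬ HasFullTree 6 S := by
  rintro ⟨x, A, B, hx, ⟨p, _, D, hp, _, q, E, F, hq, ⟨r, _, H, hr, _, s, I, _, hs,
    ⟨t, _, _, ht, _⟩, _⟩, ⟨r', K, _, hr', ⟨s', _, O, hs', _, t', _, _, ht', _⟩, _⟩⟩, _⟩
  have hA := h.mono hx.left
  have hD := hA.mono hp.right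
  have hE := hD.mono hq.left
  have hF := hD.mono hq.right
  have rD := hr.mono hq.left
  have sE := hs.mono hr.right
  have tH := ht.mono hs.left
  have tE := tH.mono hr.right
  have tD := tE.mono hq.left
  have rD' := hr'.mono hq.right
  have sF' := hs'.mono hr'.left
  have sD' := sF'.mono hq.right
  have tK' := ht'.mono hs'.right
  have tF' := tK'.mono hr'.left
  have tD' := tF'.mono hq.right
  have qA := hq.mono hp.right
  have rA' := rD'.mono hp.right
  have sA' := sD'.mono hp.right
  have e1 := h.left_right hsym hx hp rD
  have e2 := h.left_right hsym hx hp tD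
  have e3 := h.left_right hsym hx hp sD'
  have e4 := h.left_right hsym hx hp tD'
  have e5 := h.left_left hsym hx qA hr
  have e6 := h.left_left hsym hx qA tE
  have e7 := h.left_right hsym hx qA sF'
  have e8 := h.left_right hsym hx qA tF'
  have e9 := h.left_left hsym hx rA' hs'
  have e10 := h.left_left hsym hx rA' tK'
  have e11 := h.left_right hsym hx sA' ht'
  have e12 := hA.right_left hsym hp hq hr
  have e13 := hA.right_left hsym hp hq tE
  have e14 := hA.right_left hsym hp (sE.mono hq.left) ht
  have e15 := hA.right_left hsym hp rD' hs'
  have e16 := hA.right_left hsym hp rD' tK'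
  have e17 := hD.left_right hsym hq hr tH
  have e18 := hD.right_left hsym hq hr' hs'
  have e19 := hD.right_left hsym hq hr' tK'
  have e20 := hE.right_left hsym hr hs ht
  have e21 := hF.left_right hsym hr' hs' ht'
  clear * - e1 e2 e3 e4 e5 e6 e7 e8 e9 e10 e11 e12 e13 e14 e15 e16 e17 e18 e19 e20 e21
  cases hxp : φ x p <;> cases hxq : φ x q <;> cases hqr : φ q r <;>
    cases hst : φ s' t' <;> cases hxr : φ x r' <;> grind

/-- `S` contains a left comb with `k` branchings. -/
def HasLeftComb : ℕ → Finset ℕ → Prop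
  | 0, S => S.Nonempty
  | k + 1, S => ∃ d A B, IsNode S d A B ∧ HasLeftComb k A

/-- `S` contains a right comb with `k` branchings. -/
def HasRightComb : ℕ → Finset ℕ → Prop
  | 0, S => S.Nonempty
  | k + 1, S => ∃ d A B, IsNode S d A B ∧ HasRightComb k B

theorem HasLeftComb.mono {k : ℕ} {S T : Finset ℕ} (h : HasLeftComb k S) (hS : S ⊆ T) :
    HasLeftComb k T := by
  cases k with
  | zero => exact Finset.Nonempty.mono hS h
  | succ k =>
    obtain ⟨d, A, B, hd, hA⟩ := h
    exact ⟨d, A, B, hd.mono hS, hA⟩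

theorem HasRightComb.mono {k : ℕ} {S T : Finset ℕ} (h : HasRightComb k S) (hS : S ⊆ T) :
    HasRightComb k T := by
  cases k with
  | zero => exact Finset.Nonempty.mono hS h
  | succ k =>
    obtain ⟨d, A, B, hd, hA⟩ := h
    exact ⟨d, A, B, hd.mono hS, hA⟩

theorem HasLeftComb.exists_levels {k : ℕ} {S : Finset ℕ} (h : HasLeftComb k S) :
    ∃ D : Finset ℕ, D.card = k ∧
      (∀ a ∈ D, ∃ v₁ ∈ S, ∃ v₂ ∈ S, v₁ < v₂ ∧ delta v₁ v₂ = a) ∧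
      (∀ b ∈ D, ∀ c ∈ D, b < c → ∃ v₁ ∈ S, ∃ v₂ ∈ S, ∃ v₃ ∈ S, v₁ < v₂ ∧ v₂ < v₃ ∧
        delta v₁ v₂ = b ∧ delta v₂ v₃ = c) ∧
      (∀ a ∈ D, ∀ b ∈ D, ∀ c ∈ D, a < b → b < c →
        ∃ v₁ ∈ S, ∃ v₂ ∈ S, ∃ v₃ ∈ S, ∃ v₄ ∈ S, v₁ < v₂ ∧ v₂ < v₃ ∧ v₃ < v₄ ∧
          delta v₁ v₂ = a ∧ delta v₂ v₃ = b ∧ delta v₃ v₄ = c) := by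
  induction k generalizing S with
  | zero => exact ⟨∅, by simp⟩
  | succ k ih =>
    obtain ⟨d, A, B, hd, hA⟩ := h
    obtain ⟨D, hcard, h1, h2, h3⟩ := ih hA
    obtain ⟨w, hw⟩ := hd.right_nonempty
    obtain ⟨u, hu⟩ := hd.left_nonempty
    have hDd : ∀ c ∈ D, c < d := by
      intro c hc
      obtain ⟨v₁, m₁, v₂, m₂, l, rfl⟩ := h1 c hc
      exact hd.delta_lt_left m₁ m₂ l
    refine ⟨insert d D, ?_, ?_, ?_, ?_⟩
    · rw [Finset.card_insert_of_notMem fun hmem => (hDd d hmem).false, hcard]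
    · intro a ha
      obtain rfl | ha := Finset.mem_insert.1 ha
      · exact ⟨u, hd.left hu, w, hd.right hw, hd.lt u hu w hw, hd.delta_eq u hu w hw⟩
      · obtain ⟨v₁, m₁, v₂, m₂, l⟩ := h1 a ha
        exact ⟨v₁, hd.left m₁, v₂, hd.left m₂, l⟩
    · intro b hb c hc hbc
      obtain rfl | hb' := Finset.mem_insert.1 hb
      · obtain rfl | hc := Finset.mem_insert.1 hc
        · exact absurd hbc (lt_irrefl _)
        · exact absurd hbc (hDd c hc).asymm
      obtain rfl | hc := Finset.mem_insert.1 hc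
      · obtain ⟨v₁, m₁, v₂, m₂, l, e⟩ := h1 b hb'
        exact ⟨v₁, hd.left m₁, v₂, hd.left m₂, w, hd.right hw, l, hd.lt v₂ m₂ w hw, e,
          hd.delta_eq v₂ m₂ w hw⟩
      · obtain ⟨v₁, m₁, v₂, m₂, v₃, m₃, l⟩ := h2 b hb' c hc hbc
        exact ⟨v₁, hd.left m₁, v₂, hd.left m₂, v₃, hd.left m₃, l⟩
    · intro a ha b hb c hc hab hbc
      have hle : c ≤ d := by
        obtain rfl | hc := Finset.mem_insert.1 hc
        exacts [le_rfl, (hDd c hc).le]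
      have ha' := Finset.mem_of_mem_insert_of_ne ha (by omega)
      have hb' := Finset.mem_of_mem_insert_of_ne hb (by omega)
      obtain rfl | hc := Finset.mem_insert.1 hc
      · obtain ⟨v₁, m₁, v₂, m₂, v₃, m₃, l₁, l₂, e₁, e₂⟩ := h2 a ha' b hb' hab
        exact ⟨v₁, hd.left m₁, v₂, hd.left m₂, v₃, hd.left m₃, w, hd.right hw, l₁, l₂,
          hd.lt v₃ m₃ w hw, e₁, e₂, hd.delta_eq v₃ m₃ w hw⟩
      · obtain ⟨v₁, m₁, v₂, m₂, v₃, m₃, v₄, m₄, l⟩ := h3 a ha' b hb' c hc hab hbc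
        exact ⟨v₁, hd.left m₁, v₂, hd.left m₂, v₃, hd.left m₃, v₄, hd.left m₄, l⟩

theorem HasRightComb.exists_levels {k : ℕ} {S : Finset ℕ} (h : HasRightComb k S) :
    ∃ D : Finset ℕ, D.card = k ∧
      (∀ a ∈ D, ∃ v₁ ∈ S, ∃ v₂ ∈ S, v₁ < v₂ ∧ delta v₁ v₂ = a) ∧
      (∀ b ∈ D, ∀ c ∈ D, b < c → ∃ v₁ ∈ S, ∃ v₂ ∈ S, ∃ v₃ ∈ S, v₁ < v₂ ∧ v₂ < v₃ ∧
        delta v₁ v₂ = c ∧ delta v₂ v₃ = b) ∧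
      (∀ a ∈ D, ∀ b ∈ D, ∀ c ∈ D, a < b → b < c →
        ∃ v₁ ∈ S, ∃ v₂ ∈ S, ∃ v₃ ∈ S, ∃ v₄ ∈ S, v₁ < v₂ ∧ v₂ < v₃ ∧ v₃ < v₄ ∧
          delta v₁ v₂ = c ∧ delta v₂ v₃ = b ∧ delta v₃ v₄ = a) := by
  induction k generalizing S with
  | zero => exact ⟨∅, by simp⟩
  | succ k ih =>
    obtain ⟨d, A, B, hd, hA⟩ := h
    obtain ⟨D, hcard, h1, h2, h3⟩ := ih hA
    obtain ⟨w, hw⟩ := hd.right_nonempty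
    obtain ⟨u, hu⟩ := hd.left_nonempty
    have hDd : ∀ c ∈ D, c < d := by
      intro c hc
      obtain ⟨v₁, m₁, v₂, m₂, l, rfl⟩ := h1 c hc
      exact hd.delta_lt_right m₁ m₂ l
    refine ⟨insert d D, ?_, ?_, ?_, ?_⟩
    · rw [Finset.card_insert_of_notMem fun hmem => (hDd d hmem).false, hcard]
    · intro a ha
      obtain rfl | ha := Finset.mem_insert.1 ha
      · exact ⟨u, hd.left hu, w, hd.right hw, hd.lt u hu w hw, hd.delta_eq u hu w hw⟩
      · obtain ⟨v₁, m₁, v₂, m₂, l⟩ := h1 a ha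
        exact ⟨v₁, hd.right m₁, v₂, hd.right m₂, l⟩
    · intro b hb c hc hbc
      obtain rfl | hb' := Finset.mem_insert.1 hb
      · obtain rfl | hc := Finset.mem_insert.1 hc
        · exact absurd hbc (lt_irrefl _)
        · exact absurd hbc (hDd c hc).asymm
      obtain rfl | hc := Finset.mem_insert.1 hc
      · obtain ⟨v₁, m₁, v₂, m₂, l, e⟩ := h1 b hb'
        exact ⟨u, hd.left hu, v₁, hd.right m₁, v₂, hd.right m₂, hd.lt u hu v₁ m₁, l,
          hd.delta_eq u hu v₁ m₁, e⟩
      · obtain ⟨v₁, m₁, v₂, m₂, v₃, m₃, l⟩ := h2 b hb' c hc hbc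
        exact ⟨v₁, hd.right m₁, v₂, hd.right m₂, v₃, hd.right m₃, l⟩
    · intro a ha b hb c hc hab hbc
      have hle : c ≤ d := by
        obtain rfl | hc := Finset.mem_insert.1 hc
        exacts [le_rfl, (hDd c hc).le]
      have ha' := Finset.mem_of_mem_insert_of_ne ha (by omega)
      have hb' := Finset.mem_of_mem_insert_of_ne hb (by omega)
      obtain rfl | hc := Finset.mem_insert.1 hc
      · obtain ⟨v₁, m₁, v₂, m₂, v₃, m₃, l₁, l₂, e₁, e₂⟩ := h2 a ha' b hb' hab
        exact ⟨u, hd.left hu, v₁, hd.right m₁, v₂, hd.right m₂, v₃, hd.right m₃,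
          hd.lt u hu v₁ m₁, l₁, l₂, hd.delta_eq u hu v₁ m₁, e₁, e₂⟩
      · obtain ⟨v₁, m₁, v₂, m₂, v₃, m₃, v₄, m₄, l⟩ := h3 a ha' b hb' c hc hab hbc
        exact ⟨v₁, hd.right m₁, v₂, hd.right m₂, v₃, hd.right m₃, v₄, hd.right m₄, l⟩

/-- A binary tree with few consecutive left or right turns and no full subtree of `k + 1` levels
has few leaves. -/
theorem card_le_of_not_hasFullTree {h k : ℕ} {S : Finset ℕ} {a b : ℕ} (hab : a + b ≤ h)
    (ha : ¬ HasLeftComb (a + 1) S) (hb : ¬ HasRightComb (b + 1) S)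
    (hS : ¬ HasFullTree (k + 1) S) : S.card ≤ (h + 1) ^ k := by
  induction k generalizing S a b with
  | zero =>
    by_contra! hlt
    obtain ⟨d, A, B, hd, -⟩ := IsNode.exists_of_one_lt_card (by simpa using hlt)
    exact hS ⟨d, A, B, hd, hd.left_nonempty, hd.right_nonempty⟩
  | succ k ih =>
    suffices key : S.card ≤ (a + b) * (h + 1) ^ k + 1 by
      calc S.card ≤ (a + b) * (h + 1) ^ k + 1 := key
        _ ≤ h * (h + 1) ^ k + (h + 1) ^ k := by
          gcongr
          exact Nat.one_le_pow _ _ h.succ_pos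
        _ = (h + 1) ^ (k + 1) := by ring
    induction hn : S.card using Nat.strong_induction_on generalizing S a b with
    | _ m ihm =>
      subst hn
      by_cases hlt : 1 < S.card
      swap
      · omega
      obtain ⟨d, A, B, hd, hcard⟩ := IsNode.exists_of_one_lt_card hlt
      have hApos := hd.left_nonempty.card_pos
      have hBpos := hd.right_nonempty.card_pos
      by_cases hA : HasFullTree (k + 1) A
      · have hB : ¬ HasFullTree (k + 1) B := fun hB => hS ⟨d, A, B, hd, hA, hB⟩
        have hBle := ih hab (fun h' => ha (h'.mono hd.right)) (fun h' => hb (h'.mono hd.right)) hB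
        cases a with
        | zero => exact absurd ⟨d, A, B, hd, hd.left_nonempty⟩ ha
        | succ a =>
          have hAle := ihm A.card (by omega) (a := a) (b := b) (by omega)
            (fun h' => ha ⟨d, A, B, hd, h'⟩) (fun h' => hb (h'.mono hd.left))
            (fun h' => hS (h'.mono hd.left)) rfl
          calc S.card ≤ (a + b) * (h + 1) ^ k + 1 + (h + 1) ^ k := by omega
            _ = (a + 1 + b) * (h + 1) ^ k + 1 := by ring
      · have hAle := ih hab (fun h' => ha (h'.mono hd.left)) (fun h' => hb (h'.mono hd.left)) hA
        cases b with
        | zero => exact absurd ⟨d, A, B, hd, hd.right_nonempty⟩ hb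
        | succ b =>
          have hBle := ihm B.card (by omega) (a := a) (b := b) (by omega)
            (fun h' => ha (h'.mono hd.right)) (fun h' => hb ⟨d, A, B, hd, h'⟩)
            (fun h' => hS (h'.mono hd.right)) rfl
          calc S.card ≤ (a + b) * (h + 1) ^ k + 1 + (h + 1) ^ k := by omega
            _ = (a + (b + 1)) * (h + 1) ^ k + 1 := by ring

theorem delta_lt_of_lt_two_pow {a b N : ℕ} (hab : a < b) (hb : b < 2 ^ N) : delta a b < N := by
  rw [delta_lt_iff hab.ne, Nat.div_eq_of_lt hb, Nat.div_eq_of_lt (hab.trans hb)]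

theorem independence_number_bound (n N : ℕ) (hn : 5 ≤ n) (hN : 1 ≤ N)
    (φ : ℕ → ℕ → Bool) (hsym : ∀ a b, φ a b = φ b a)
    (hφ : ∀ A : Finset ℕ, A ⊆ Finset.range N → A.card = n →
      ∃ a ∈ A, ∃ b ∈ A, ∃ c ∈ A, a < b ∧ b < c ∧ φ a b = φ b c ∧ φ a b ≠ φ a c) :
    ∀ S : Finset ℕ, (∀ x ∈ S, x < 2 ^ N) → S.card = 2 ^ 6 * n ^ 5 + 1 →
      ∃ v₁ ∈ S, ∃ v₂ ∈ S, ∃ v₃ ∈ S, ∃ v₄ ∈ S,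
        v₁ < v₂ ∧ v₂ < v₃ ∧ v₃ < v₄ ∧ IsEdge φ v₁ v₂ v₃ v₄ := by
  intro S hSN hcard
  by_contra! hno
  have hS : IsIndep φ S := hno
  have hleft : ¬ HasLeftComb n S := by
    intro hcomb
    obtain ⟨D, hD, h1, -, h3⟩ := hcomb.exists_levels
    have hDN : D ⊆ Finset.range N := by
      intro c hc
      obtain ⟨v₁, -, v₂, m₂, l, rfl⟩ := h1 c hc
      exact Finset.mem_range.2 (delta_lt_of_lt_two_pow l (hSN v₂ m₂))
    obtain ⟨a, ha, b, hb, c, hc, hab, hbc, heq, hne⟩ := hφ D hDN hD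
    obtain ⟨v₁, m₁, v₂, m₂, v₃, m₃, v₄, m₄, l₁, l₂, l₃, rfl, rfl, rfl⟩ :=
      h3 a ha b hb c hc hab hbc
    exact hS v₁ m₁ v₂ m₂ v₃ m₃ v₄ m₄ l₁ l₂ l₃ (Or.inl ⟨Or.inl ⟨hab, hbc⟩, heq, hne⟩)
  have hright : ¬ HasRightComb n S := by
    intro hcomb
    obtain ⟨D, hD, h1, -, h3⟩ := hcomb.exists_levels
    have hDN : D ⊆ Finset.range N := by
      intro c hc
      obtain ⟨v₁, -, v₂, m₂, l, rfl⟩ := h1 c hc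
      exact Finset.mem_range.2 (delta_lt_of_lt_two_pow l (hSN v₂ m₂))
    obtain ⟨a, ha, b, hb, c, hc, hab, hbc, heq, hne⟩ := hφ D hDN hD
    obtain ⟨v₁, m₁, v₂, m₂, v₃, m₃, v₄, m₄, l₁, l₂, l₃, rfl, rfl, rfl⟩ :=
      h3 a ha b hb c hc hab hbc
    refine hS v₁ m₁ v₂ m₂ v₃ m₃ v₄ m₄ l₁ l₂ l₃ (Or.inl ⟨Or.inr ⟨hbc, hab⟩, ?_, ?_⟩)
    · rw [hsym (delta v₁ v₂), ← heq, hsym (delta v₃ v₄)]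
    · rw [hsym (delta v₁ v₂) (delta v₂ v₃), ← heq, hsym (delta v₁ v₂)]
      exact hne
  obtain ⟨m, rfl⟩ : ∃ m, n = m + 1 := ⟨n - 1, by omega⟩
  have hle := card_le_of_not_hasFullTree le_rfl hleft hright (hS.not_hasFullTree_six hsym)
  have hpow : (m + m + 1) ^ 5 ≤ (2 * (m + 1)) ^ 5 := Nat.pow_le_pow_left (by omega) 5
  rw [mul_pow] at hpow
  omega
end
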